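/- Let C be a category with binary coproducts and X an object of C. For every automorphism w of X, the automorphism w ⊔ w⁻¹ of X ⊔ X is a commutator: there exist automorphisms a, b of X ⊔ X with w ⊔ w⁻¹ = a·b·a⁻¹·b⁻¹. (This is the instance of Whitehead's lemma in a symmetric monoidal category used in the proof that the commutator subgroup of the stable automorphism group is perfect.) -/

import Mathlib

open CategoryTheory CategoryTheory.Limits

universe u v

variable {C : Type u} [Category.{v} C]

/-- The coproduct `u ⊔ v` of two automorphisms, as an automorphism of the
coproduct: applied to automorphisms, `coprod.map` defines the map
`Aut X × Aut Y → Aut (X ⊔ Y)`. -/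
noncomputable def coprodAut [HasBinaryCoproducts C] {X Y : C}
    (u : Aut X) (v : Aut Y) : Aut (X ⨿ Y) :=
  coprod.mapIso u v

theorem aut_mul_hom {X : C} (f g : Aut X) : (f * g).hom = g.hom ≫ f.hom :=
  rfl

theorem aut_inv_hom {X : C} (f : Aut X) : (f⁻¹).hom = f.inv :=
  rfl

theorem coprodAut_hom [HasBinaryCoproducts C] {X Y : C} (u : Aut X) (v : Aut Y) :
    (coprodAut u v).hom = coprod.map u.hom v.hom :=
  rfl

theorem coprodAut_mul [HasBinaryCoproducts C] {X Y : C} (u u' : Aut X) (v v' : Aut Y) :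
    coprodAut (u * u') (v * v') = coprodAut u v * coprodAut u' v' := by
  apply Aut.ext
  simp [aut_mul_hom, coprodAut_hom]

theorem coprodAut_inv [HasBinaryCoproducts C] {X Y : C} (u : Aut X) (v : Aut Y) :
    (coprodAut u v)⁻¹ = coprodAut u⁻¹ v⁻¹ :=
  rfl

/-- The symmetry of `X ⊔ X` exchanging the two summands. -/
noncomputable def coprodSwap [HasBinaryCoproducts C] (X : C) : Aut (X ⨿ X) :=
  coprod.braiding X X

theorem coprodSwap_hom [HasBinaryCoproducts C] (X : C) :
    (coprodSwap X).hom = coprod.desc coprod.inr coprod.inl :=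
  rfl

theorem coprodSwap_inv [HasBinaryCoproducts C] (X : C) :
    (coprodSwap X).inv = coprod.desc coprod.inr coprod.inl :=
  rfl

theorem coprodSwap_conj_coprodAut [HasBinaryCoproducts C] {X : C} (u v : Aut X) :
    coprodSwap X * coprodAut u v * (coprodSwap X)⁻¹ = coprodAut v u := by
  apply Aut.ext
  ext <;> simp [aut_mul_hom, aut_inv_hom, coprodAut_hom, coprodSwap_hom, coprodSwap_inv,
    coprod.inl_desc, coprod.inr_desc]

/-- Whitehead's lemma in a category with binary coproducts: for every
automorphism `w` of `X`, the automorphism `w ⊔ w⁻¹` of `X ⊔ X` is a commutator. -/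
theorem coprodAut_inv_is_commutator [HasBinaryCoproducts C] (X : C) (w : Aut X) :
    ∃ a b : Aut (X ⨿ X), coprodAut w w⁻¹ = a * b * a⁻¹ * b⁻¹ := by
  refine ⟨coprodAut w 1, coprodSwap X, ?_⟩
  rw [mul_assoc, mul_assoc, ← mul_assoc (coprodSwap X), coprodAut_inv,
    coprodSwap_conj_coprodAut, ← coprodAut_mul]
  simp
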